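/- Let p be a prime, M a finitely generated module over the ring ℤ_p of p-adic integers, and j a nonzero integer. Then the kernel {x ∈ M : j·x = 0} and the cokernel M/jM of multiplication by j on M are both finite, and #(M/jM) = #{x ∈ M : j·x = 0} · p^{r·v_p(j)}, where r = dim_{ℚ_p}(ℚ_p ⊗_{ℤ_p} M) is the rank of M and v_p(j) is the p-adic valuation of j. (This is the identity χ^×(fib(C →^j C)) = j^{−χ(C_ℚ)} for perfect complexes of ℤ_p-modules, used in the local volume computation, expressed at the level of a single finitely generated module.) -/

import Mathlib

open TensorProduct

section aux

variable {R : Type*} [CommRing R]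

/-- Kernel and cokernel of multiplication by `c` are finite, with ratio of cardinalities `q`. -/
def KC (c : R) (M : Type*) [AddCommGroup M] [Module R M] (q : ℕ) : Prop :=
  Finite (LinearMap.ker (c • (LinearMap.id : M →ₗ[R] M))) ∧
  Finite (M ⧸ LinearMap.range (c • (LinearMap.id : M →ₗ[R] M))) ∧
  Nat.card (M ⧸ LinearMap.range (c • (LinearMap.id : M →ₗ[R] M))) =
    Nat.card (LinearMap.ker (c • (LinearMap.id : M →ₗ[R] M))) * q

theorem KC_equiv {c : R} {M N : Type*} [AddCommGroup M] [Module R M] [AddCommGroup N] [Module R N]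
    (e : M ≃ₗ[R] N) {q : ℕ} (h : KC c N q) : KC c M q := by
  obtain ⟨h1, h2, h3⟩ := h
  have ek : LinearMap.ker (c • (LinearMap.id : M →ₗ[R] M)) ≃
      LinearMap.ker (c • (LinearMap.id : N →ₗ[R] N)) :=
    e.toEquiv.subtypeEquiv (fun a => by
      simp only [LinearMap.mem_ker, LinearMap.smul_apply, LinearMap.id_apply]
      change _ ↔ c • e a = 0
      rw [← map_smul, LinearEquiv.map_eq_zero_iff])
  have eq : (M ⧸ LinearMap.range (c • (LinearMap.id : M →ₗ[R] M))) ≃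
      (N ⧸ LinearMap.range (c • (LinearMap.id : N →ₗ[R] N))) :=
    (Submodule.Quotient.equiv _ _ e (by
      rw [← LinearMap.range_comp]
      ext y
      simp only [LinearMap.mem_range, LinearMap.comp_apply, LinearMap.smul_apply,
        LinearMap.id_apply]
      constructor
      · rintro ⟨x, rfl⟩
        exact ⟨e x, by simp⟩
      · rintro ⟨x, rfl⟩
        exact ⟨e.symm x, by simp⟩)).toEquiv
  exact ⟨Finite.of_equiv _ ek.symm, Finite.of_equiv _ eq.symm, by
    rw [Nat.card_congr ek, Nat.card_congr eq, h3]⟩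

theorem KC_prod {c : R} {M N : Type*} [AddCommGroup M] [Module R M] [AddCommGroup N] [Module R N]
    {q q' : ℕ} (h : KC c M q) (h' : KC c N q') : KC c (M × N) (q * q') := by
  obtain ⟨h1, h2, h3⟩ := h
  obtain ⟨h1', h2', h3'⟩ := h'
  have ek : LinearMap.ker (c • (LinearMap.id : M × N →ₗ[R] M × N)) ≃
      LinearMap.ker (c • (LinearMap.id : M →ₗ[R] M)) ×
      LinearMap.ker (c • (LinearMap.id : N →ₗ[R] N)) :=
    { toFun := fun x => (⟨x.1.1, congrArg Prod.fst (LinearMap.mem_ker.mp x.2)⟩,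
        ⟨x.1.2, congrArg Prod.snd (LinearMap.mem_ker.mp x.2)⟩)
      invFun := fun x => ⟨(x.1.1, x.2.1), 
        Prod.ext (LinearMap.mem_ker.mp x.1.2) (LinearMap.mem_ker.mp x.2.2)⟩
      left_inv := fun x => rfl
      right_inv := fun x => rfl }
  have eq : ((M × N) ⧸ LinearMap.range (c • (LinearMap.id : M × N →ₗ[R] M × N))) ≃
      (M ⧸ LinearMap.range (c • (LinearMap.id : M →ₗ[R] M))) ×
      (N ⧸ LinearMap.range (c • (LinearMap.id : N →ₗ[R] N))) := by
    let f := (LinearMap.range (c • (LinearMap.id : M →ₗ[R] M))).mkQ.prodMap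
      (LinearMap.range (c • (LinearMap.id : N →ₗ[R] N))).mkQ
    have hf : Function.Surjective f :=
      Function.Surjective.prodMap (Submodule.mkQ_surjective _) (Submodule.mkQ_surjective _)
    have hk : LinearMap.range (c • (LinearMap.id : M × N →ₗ[R] M × N)) = LinearMap.ker f := by
      rw [LinearMap.ker_prodMap, Submodule.ker_mkQ, Submodule.ker_mkQ]
      ext ⟨x, y⟩
      simp [Prod.ext_iff]
    exact ((Submodule.quotEquivOfEq _ _ hk).trans (f.quotKerEquivOfSurjective hf)).toEquiv
  exact ⟨Finite.of_equiv _ ek.symm, Finite.of_equiv _ eq.symm, by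
    rw [Nat.card_congr ek, Nat.card_congr eq, Nat.card_prod, Nat.card_prod, h3, h3']; ring⟩

theorem KC_finite (c : R) (M : Type*) [AddCommGroup M] [Module R M] [Finite M] : KC c M 1 := by
  refine ⟨inferInstance,
    Finite.of_surjective _ (Submodule.mkQ_surjective _), ?_⟩
  set f := c • (LinearMap.id : M →ₗ[R] M)
  have h1 := Submodule.card_eq_card_quotient_mul_card (LinearMap.range f)
  have h2 := Submodule.card_eq_card_quotient_mul_card (LinearMap.ker f)
  rw [Nat.card_congr f.quotKerEquivRange.toEquiv] at h2
  have h3 : 0 < Nat.card (LinearMap.range f) := Nat.card_pos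
  rw [mul_one]
  apply Nat.eq_of_mul_eq_mul_left h3
  first | linarith | (rw [mul_comm] at h1 h2; linarith)

theorem KC_pow {c : R} {q : ℕ} (h : KC c R q) (n : ℕ) : KC c (Fin n → R) (q ^ n) := by
  induction n with
  | zero => simpa using KC_finite c (Fin 0 → R)
  | succ n ih =>
    rw [pow_succ']
    exact KC_equiv (Fin.consLinearEquiv R (fun _ => R)).symm (KC_prod h ih)

end aux

theorem padicInt_quot_equiv {p : ℕ} [Fact p.Prime] {x : ℤ_[p]} (hx : x ≠ 0) :
    Nonempty ((ℤ_[p] ⧸ Ideal.span {x}) ≃ ZMod (p ^ x.valuation)) := by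
  have h : Ideal.span {x} = RingHom.ker (PadicInt.toZModPow (p := p) x.valuation) := by
    rw [PadicInt.ker_toZModPow, Ideal.span_singleton_eq_span_singleton]
    refine Associated.symm ⟨PadicInt.unitCoeff hx, ?_⟩
    rw [mul_comm]
    exact (PadicInt.unitCoeff_spec hx).symm
  exact ⟨((Ideal.quotEquivOfEq h).trans
    (RingHom.quotientKerEquivOfSurjective (ZMod.ringHom_surjective _))).toEquiv⟩

theorem padicInt_quot_finite {p : ℕ} [Fact p.Prime] {x : ℤ_[p]} (hx : x ≠ 0) :
    Finite (ℤ_[p] ⧸ Ideal.span {x}) := by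
  obtain ⟨e⟩ := padicInt_quot_equiv hx
  have : NeZero (p ^ x.valuation) := ⟨pow_ne_zero _ (Fact.out : p.Prime).ne_zero⟩
  exact Finite.of_equiv _ e.symm

theorem KC_padicInt {p : ℕ} [Fact p.Prime] {x : ℤ_[p]} (hx : x ≠ 0) :
    KC x ℤ_[p] (p ^ x.valuation) := by
  have hk : LinearMap.ker (x • (LinearMap.id : ℤ_[p] →ₗ[ℤ_[p]] ℤ_[p])) = ⊥ := by
    ext y; simp [hx]
  have hr : LinearMap.range (x • (LinearMap.id : ℤ_[p] →ₗ[ℤ_[p]] ℤ_[p])) = Ideal.span {x} := by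
    ext y
    simp only [LinearMap.mem_range, LinearMap.smul_apply, LinearMap.id_apply, smul_eq_mul,
      Ideal.mem_span_singleton]
    exact ⟨fun ⟨z, h⟩ => ⟨z, h.symm⟩, fun ⟨z, h⟩ => ⟨z, h.symm⟩⟩
  unfold KC
  rw [hk, hr]
  refine ⟨inferInstance, padicInt_quot_finite hx, ?_⟩
  obtain ⟨e⟩ := padicInt_quot_equiv hx
  rw [Nat.card_congr e, Nat.card_zmod]
  simp

/-- Let `p` be a prime, `M` a finitely generated module over `ℤ_p`, and
`j` a nonzero integer.  Then the kernel `{x ∈ M : j·x = 0}` and the cokernel `M/jM` of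
multiplication by `j` on `M` are both finite, and
`#(M/jM) = #{x ∈ M : j·x = 0} · p^{r·v_p(j)}`, where `r = dim_{ℚ_p}(ℚ_p ⊗_{ℤ_p} M)` is
the rank of `M` and `v_p(j)` is the `p`-adic valuation of `j`. -/
theorem card_cokernel_eq_card_kernel_mul_pow
    (p : ℕ) [Fact p.Prime] (M : Type*) [AddCommGroup M] [Module ℤ_[p] M]
    [Module.Finite ℤ_[p] M] (j : ℤ) (hj : j ≠ 0) :
    Finite (LinearMap.ker ((j : ℤ_[p]) • (LinearMap.id : M →ₗ[ℤ_[p]] M))) ∧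
    Finite (M ⧸ LinearMap.range ((j : ℤ_[p]) • (LinearMap.id : M →ₗ[ℤ_[p]] M))) ∧
    Nat.card (M ⧸ LinearMap.range ((j : ℤ_[p]) • (LinearMap.id : M →ₗ[ℤ_[p]] M))) =
      Nat.card (LinearMap.ker ((j : ℤ_[p]) • (LinearMap.id : M →ₗ[ℤ_[p]] M))) *
        p ^ (Module.finrank ℚ_[p] (ℚ_[p] ⊗[ℤ_[p]] M) * padicValInt p j) := by
  classical
  change KC (j : ℤ_[p]) M _
  have hj' : (j : ℤ_[p]) ≠ 0 := by exact_mod_cast hj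
  have hv : (j : ℤ_[p]).valuation = padicValInt p j := by
    have h1 := PadicInt.valuation_coe (j : ℤ_[p])
    have h2 := Padic.valuation_intCast (p := p) j
    rw [PadicInt.coe_intCast] at h1
    omega
  obtain ⟨n, ι, _, π, hπ, e, ⟨E⟩⟩ := Module.equiv_free_prod_directSum ℤ_[p] M
  set T := DirectSum ι fun i => ℤ_[p] ⧸ Submodule.span ℤ_[p] {π i ^ e i} with hT
  have hfin (i : ι) : Finite (ℤ_[p] ⧸ Submodule.span ℤ_[p] {π i ^ e i}) :=
    padicInt_quot_finite (pow_ne_zero _ (hπ i).ne_zero)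
  have : Finite T := Finite.of_equiv _
    (DirectSum.linearEquivFunOnFintype ℤ_[p] ι
      (fun i => ℤ_[p] ⧸ Submodule.span ℤ_[p] {π i ^ e i})).symm.toEquiv
  have hrank : Module.finrank ℚ_[p] (ℚ_[p] ⊗[ℤ_[p]] M) = n := by
    rw [(TensorProduct.isBaseChange ℤ_[p] M ℚ_[p]).finrank_eq, E.finrank_eq]
    let f := LinearMap.fst ℤ_[p] (Fin n →₀ ℤ_[p]) T
    have hle : LinearMap.ker f ≤ Submodule.torsion ℤ_[p] ((Fin n →₀ ℤ_[p]) × T) := by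
      rintro ⟨x, t⟩ hx
      have hx0 : x = 0 := hx
      subst hx0
      rw [Submodule.mem_torsion_iff]
      have hc : ((Nat.card T : ℕ) : ℤ_[p]) ≠ 0 := by
        exact_mod_cast (Nat.card_pos (α := T)).ne'
      refine ⟨⟨_, mem_nonZeroDivisors_of_ne_zero hc⟩, ?_⟩
      have : (Nat.card T) • t = 0 := card_nsmul_eq_zero'
      rw [Submonoid.mk_smul, Nat.cast_smul_eq_nsmul]
      simp [Prod.ext_iff, this]
    rw [← finrank_quotient_eq_of_le_torsion hle,
      (f.quotKerEquivOfSurjective LinearMap.fst_surjective).finrank_eq]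
    simp
  rw [hrank, ← hv, mul_comm, pow_mul]
  have h := KC_prod (KC_equiv (Finsupp.linearEquivFunOnFinite ℤ_[p] ℤ_[p] (Fin n))
    (KC_pow (KC_padicInt hj') n)) (KC_finite (j : ℤ_[p]) T)
  rw [mul_one] at h
  exact KC_equiv E h
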